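/- arXiv:2409.07168 — 6 statements merged into one kernel-verified Lean document; each statement's English description precedes it below -/
import Mathlib

section
/- Let n and m be positive integers, let f : ℝⁿ → ℝ be twice continuously differentiable with m_f·I ⪯ ∇²f(x) ⪯ L·I for all x (where 0 < m_f ≤ L), let C be a real m×n matrix and d ∈ ℝᵐ with c̲·I ⪯ C·Cᵀ ⪯ c̄·I for some 0 < c̲ ≤ c̄, and let 0 < ρ < 1/c̄ and K_i ≥ K_p > 0. Let (x⋆, λ⋆) ∈ ℝⁿ × ℝᵐ be an equilibrium of the PI dynamics, i.e. ∇f(x⋆) + Σ_{j=1}^m max(ρ(Cx⋆−d)_j + λ⋆_j, 0)·C_jᵀ = 0 and max(ρ(Cx⋆−d)_j + λ⋆_j, 0) = λ⋆_j for every j. Set g̲ = m_f, ḡ = L + ρc̄ and μ = min{ (1/2)K_p c̲, (2K_i g̲ − K_p ḡ²)/K_i }, and assume μ > 0. Then for every continuously differentiable solution (x(t), λ(t)) of the PI dynamics ẋ(t) = −∇f(x(t)) − Σ_{j=1}^m max(ρ(Cx(t)−d)_j + λ_j(t), 0)·C_jᵀ, λ̇_j(t) = (K_i/ρ)(max(ρ(Cx(t)−d)_j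 + λ_j(t), 0) − λ_j(t)) + K_p (C ẋ(t))_j on [0,∞), there exist real constants α₁ > 0 and α₂ > 0 such that ‖x(t) − x⋆‖₂ ≤ α₁ e^{−μt/2} and ‖λ(t) − λ⋆‖₂ ≤ α₂ e^{−μt/2} for all t ≥ 0. -/
open Matrix Set

/-- Transport a plain vector in `Fin k → ℝ` into `EuclideanSpace ℝ (Fin k)`. -/
noncomputable def toEuc {k : ℕ} (v : Fin k → ℝ) : EuclideanSpace ℝ (Fin k) :=
  (EuclideanSpace.equiv (Fin k) ℝ).symm v

lemma aux_sq {a b : ℝ} (h : a ^ 2 ≤ b ^ 2) (hb : 0 ≤ b) : a ≤ b :=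
  (le_abs_self a).trans (abs_le_of_sq_le_sq h hb)

lemma aux_max (a b : ℝ) : ∃ γ : ℝ, 0 ≤ γ ∧ γ ≤ 1 ∧ max a 0 - max b 0 = γ * (a - b) := by
  by_cases h : a = b
  · exact ⟨0, le_refl _, zero_le_one, by simp [h]⟩
  · have hab : a - b ≠ 0 := sub_ne_zero.mpr h
    refine ⟨(max a 0 - max b 0) / (a - b), ?_, ?_, by field_simp⟩
    · rcases lt_or_gt_of_ne hab with h1 | h1
      · apply div_nonneg_of_nonpos _ h1.le
        have : max a 0 ≤ max b 0 := max_le_max (by linarith) le_rfl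
        linarith
      · apply div_nonneg _ h1.le
        have : max b 0 ≤ max a 0 := max_le_max (by linarith) le_rfl
        linarith
    · rcases lt_or_gt_of_ne hab with h1 | h1
      · rw [div_le_one_of_neg h1]
        rcases max_cases a 0 with h2 | h2 <;> rcases max_cases b 0 with h3 | h3 <;> linarith
      · rw [div_le_one h1]
        rcases max_cases a 0 with h2 | h2 <;> rcases max_cases b 0 with h3 | h3 <;> linarith

lemma aux_core {E F : Type*} [NormedAddCommGroup E] [InnerProductSpace ℝ E]
    [NormedAddCommGroup F] [InnerProductSpace ℝ F]
    (A : E →ₗ[ℝ] F) (T : F →ₗ[ℝ] E) (hadj : ∀ w z, inner ℝ (T w) z = inner ℝ w (A z))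
    (mf L cl cu ρ Ki Kp μ : ℝ) (hL : 0 < L) (hcl : 0 < cl) (hclcu : cl ≤ cu)
    (hT1 : ∀ w, cl * ‖w‖ ^ 2 ≤ ‖T w‖ ^ 2) (hT2 : ∀ w, ‖T w‖ ^ 2 ≤ cu * ‖w‖ ^ 2)
    (hρ : 0 < ρ) (hρcu : ρ < 1 / cu) (hKp : 0 < Kp) (hKiKp : Kp ≤ Ki)
    (hμ1 : μ ≤ 1 / 2 * Kp * cl)
    (hμ2 : μ ≤ (2 * Ki * mf - Kp * (L + ρ * cu) ^ 2) / Ki)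
    (z h : E) (w r q : F)
    (hh1 : mf * ‖z‖ ^ 2 ≤ inner ℝ h z) (hh2 : ‖h‖ ≤ L * ‖z‖)
    (hr1 : 0 ≤ inner ℝ r (A z)) (hr2 : ‖r‖ ≤ ‖A z‖) (hrq : inner ℝ r w = inner ℝ q (A z))
    (hs : ‖w - q‖ ^ 2 ≤ inner ℝ (w - q) w) (z' : E) (w' : F)
    (hz' : z' = -h - T (ρ • r + q))
    (hw' : w' = (Ki / ρ) • (ρ • r + q - w) + Kp • A z') :
    2 * Ki * inner ℝ z z' + 2 * inner ℝ w w' ≤ - μ * (Ki * ‖z‖ ^ 2 + ‖w‖ ^ 2) := by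
  have hKi : 0 < Ki := by linarith
  have hcu : 0 < cu := by linarith
  set g := h + ρ • T r with hg
  set s := w - q with hsd
  have hq : q = w - s := by rw [hsd]; abel
  have hAz : ‖A z‖ ^ 2 ≤ cu * ‖z‖ ^ 2 := by
    have h1 : ‖A z‖ ^ 2 = inner ℝ (T (A z)) z := by rw [hadj, real_inner_self_eq_norm_sq]
    have h2 := real_inner_le_norm (T (A z)) z
    have h3 := hT2 (A z)
    have h4 : (‖A z‖ ^ 2) ^ 2 ≤ (cu * ‖z‖ ^ 2) * ‖A z‖ ^ 2 := by
      calc (‖A z‖ ^ 2) ^ 2 ≤ (‖T (A z)‖ * ‖z‖) ^ 2 := by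
            apply pow_le_pow_left₀ (by positivity); linarith
        _ = ‖T (A z)‖ ^ 2 * ‖z‖ ^ 2 := by ring
        _ ≤ (cu * ‖A z‖ ^ 2) * ‖z‖ ^ 2 := by gcongr
        _ = _ := by ring
    rcases (sq_nonneg ‖A z‖).eq_or_lt with h5 | h5
    · rw [← h5]; positivity
    · rw [sq (‖A z‖ ^ 2)] at h4
      exact le_of_mul_le_mul_right h4 h5
  have hTr : ‖T r‖ ≤ cu * ‖z‖ := by
    apply aux_sq _ (by positivity)
    calc ‖T r‖ ^ 2 ≤ cu * ‖r‖ ^ 2 := hT2 r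
      _ ≤ cu * ‖A z‖ ^ 2 := by gcongr
      _ ≤ cu * (cu * ‖z‖ ^ 2) := by gcongr
      _ = _ := by ring
  have hgn : ‖g‖ ≤ (L + ρ * cu) * ‖z‖ := by
    calc ‖g‖ ≤ ‖h‖ + ‖ρ • T r‖ := norm_add_le _ _
      _ = ‖h‖ + ρ * ‖T r‖ := by rw [norm_smul, Real.norm_of_nonneg hρ.le]
      _ ≤ L * ‖z‖ + ρ * (cu * ‖z‖) := by gcongr
      _ = _ := by ring
  have hgn2 : ‖g‖ ^ 2 ≤ (L + ρ * cu) ^ 2 * ‖z‖ ^ 2 := by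
    rw [← mul_pow]; exact pow_le_pow_left₀ (norm_nonneg _) hgn 2
  have hz2 : z' = -g - T w + T s := by
    rw [hz', hq, hg]; simp only [map_add, map_sub, map_smul]; abel
  have e1 : inner ℝ z z' = - inner ℝ h z - ρ * inner ℝ r (A z) - inner ℝ q (A z) := by
    rw [hz', real_inner_comm]
    simp only [inner_sub_left, inner_neg_left, map_add, map_smul, inner_add_left,
      real_inner_smul_left, hadj]
    ring
  have e2 : inner ℝ w w' = Ki * inner ℝ r w - Ki / ρ * inner ℝ s w
      - Kp * inner ℝ (T w) g - Kp * ‖T w‖ ^ 2 + Kp * inner ℝ (T w) (T s) := by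
    have : inner ℝ w (A z') = - inner ℝ (T w) g - ‖T w‖ ^ 2 + inner ℝ (T w) (T s) := by
      rw [← hadj, hz2]
      simp only [inner_sub_right, inner_neg_right, inner_add_right, real_inner_self_eq_norm_sq]
    rw [hw', inner_add_right, real_inner_smul_right, real_inner_smul_right, this]
    have : ρ • r + q - w = ρ • r - s := by rw [hsd]; abel
    rw [this, inner_sub_right, real_inner_smul_right, real_inner_comm r w, real_inner_comm s w]
    field_simp
    ring
  have f1 : 0 ≤ ‖T w‖ ^ 2 + 2 * inner ℝ (T w) g + ‖g‖ ^ 2 := by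
    rw [← norm_add_sq_real]; positivity
  have f2 : 0 ≤ ‖T w‖ ^ 2 - 4 * inner ℝ (T w) (T s) + 4 * ‖T s‖ ^ 2 := by
    have := norm_sub_sq_real (T w) ((2:ℝ) • T s)
    rw [real_inner_smul_right, norm_smul, Real.norm_of_nonneg (by norm_num)] at this
    nlinarith [sq_nonneg ‖T w - (2:ℝ) • T s‖]
  have f3 : ‖T s‖ ^ 2 ≤ cu * inner ℝ s w := (hT2 s).trans (by gcongr)
  have hsw : 0 ≤ inner ℝ s w := (sq_nonneg _).trans hs
  have f4 : Kp * cu ≤ Ki / ρ := by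
    rw [le_div_iff₀ hρ]
    rw [lt_div_iff₀ hcu] at hρcu
    nlinarith
  have f5 : Kp * ‖T s‖ ^ 2 ≤ Ki / ρ * inner ℝ s w := by
    calc Kp * ‖T s‖ ^ 2 ≤ Kp * (cu * inner ℝ s w) := by gcongr
      _ = (Kp * cu) * inner ℝ s w := by ring
      _ ≤ _ := by gcongr
  have f6 : μ * Ki * ‖z‖ ^ 2 ≤ (2 * Ki * mf - Kp * (L + ρ * cu) ^ 2) * ‖z‖ ^ 2 := by
    rw [le_div_iff₀ hKi] at hμ2
    gcongr
  have f7 : μ * ‖w‖ ^ 2 ≤ 1 / 2 * Kp * ‖T w‖ ^ 2 := by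
    calc μ * ‖w‖ ^ 2 ≤ 1 / 2 * Kp * cl * ‖w‖ ^ 2 := by gcongr
      _ = 1 / 2 * Kp * (cl * ‖w‖ ^ 2) := by ring
      _ ≤ _ := by gcongr; exact hT1 w
  have g1 := mul_nonneg hKp.le f1
  have g2 := mul_nonneg hKp.le f2
  have g3 := mul_le_mul_of_nonneg_left hgn2 hKp.le
  have g4 := mul_le_mul_of_nonneg_left hh1 hKi.le
  have g5 := mul_nonneg (mul_nonneg hKi.le hρ.le) hr1
  rw [e1, e2, hrq]
  linarith

lemma aux_grad {E : Type*} [NormedAddCommGroup E] [InnerProductSpace ℝ E] [CompleteSpace E]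
    (f : E → ℝ) (hf : ContDiff ℝ 2 f) (a b u : E) :
    ∃ y, inner ℝ (gradient f b - gradient f a) u = iteratedFDeriv ℝ 2 f y ![b - a, u] := by
  have hd : Differentiable ℝ (fderiv ℝ f) :=
    (hf.fderiv_right (m := 1) (by norm_num)).differentiable (by norm_num)
  have hder : ∀ t : ℝ, HasDerivAt (fun t : ℝ => fderiv ℝ f (a + t • (b - a)) u)
      (fderiv ℝ (fderiv ℝ f) (a + t • (b - a)) (b - a) u) t := by
    intro t
    have h1 : HasDerivAt (fun t : ℝ => a + t • (b - a)) (b - a) t := by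
      simpa using ((hasDerivAt_id t).smul_const (b - a)).const_add a
    have h2 := (hd (a + t • (b - a))).hasFDerivAt.comp_hasDerivAt t h1
    simpa using h2.clm_apply (hasDerivAt_const t u)
  obtain ⟨c, -, hc⟩ := exists_hasDerivAt_eq_slope _ _ (zero_lt_one (α := ℝ))
    (fun t _ => (hder t).continuousAt.continuousWithinAt) (fun t _ => hder t)
  refine ⟨a + c • (b - a), ?_⟩
  rw [iteratedFDeriv_two_apply]
  simp only [Matrix.cons_val_zero, Matrix.cons_val_one]
  rw [hc, inner_sub_left]
  simp [gradient, InnerProductSpace.toDual_symm_apply]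

lemma aux_hess {E : Type*} [NormedAddCommGroup E] [InnerProductSpace ℝ E] [CompleteSpace E]
    (f : E → ℝ) (hf : ContDiff ℝ 2 f) (mf L : ℝ) (hmf : 0 < mf) (hmL : mf ≤ L)
    (hHess : ∀ y v : E,
      mf * ‖v‖ ^ 2 ≤ iteratedFDeriv ℝ 2 f y ![v, v] ∧
      iteratedFDeriv ℝ 2 f y ![v, v] ≤ L * ‖v‖ ^ 2) (y v u : E) :
    iteratedFDeriv ℝ 2 f y ![v, u] ≤ L * ‖v‖ * ‖u‖ := by
  have hL : 0 < L := by linarith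
  have key : ∀ p q : E, iteratedFDeriv ℝ 2 f y ![p, q] =
      fderiv ℝ (fderiv ℝ f) y p q := fun p q => by
    rw [iteratedFDeriv_two_apply]; simp
  have hsymm : ∀ p q : E, fderiv ℝ (fderiv ℝ f) y p q = fderiv ℝ (fderiv ℝ f) y q p := by
    have := (hf.contDiffAt (x := y)).isSymmSndFDerivAt (by simp)
    exact fun p q => this p q
  have H := fun v => hHess y v
  simp only [key] at H ⊢
  set B := fderiv ℝ (fderiv ℝ f) y
  have hq : ∀ s : ℝ, 0 ≤ (B u u) * (s * s) + (2 * B v u) * s + B v v := by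
    intro s
    have h1 := (H (v + s • u)).1
    have h2 : 0 ≤ B (v + s • u) (v + s • u) := le_trans (by positivity) h1
    simp only [map_add, map_smul, _root_.add_apply, _root_.smul_apply,
      smul_eq_mul] at h2
    rw [hsymm u v] at h2
    nlinarith
  have hd := discrim_le_zero hq
  unfold discrim at hd
  have h1 := (H v).2
  have h2 := (H u).2
  have h3 : 0 ≤ B u u := le_trans (by positivity) (H u).1
  apply aux_sq _ (by positivity)
  calc (B v u) ^ 2 ≤ B v v * B u u := by nlinarith
    _ ≤ (L * ‖v‖ ^ 2) * (L * ‖u‖ ^ 2) := by gcongr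
    _ = _ := by ring

lemma aux_decay (V V' : ℝ → ℝ) (μ : ℝ)
    (hV : ∀ t ∈ Ici (0 : ℝ), HasDerivWithinAt V (V' t) (Ici 0) t)
    (hle : ∀ t ∈ Ici (0 : ℝ), V' t ≤ -μ * V t) (t : ℝ) (ht : 0 ≤ t) :
    V t ≤ V 0 * Real.exp (-(μ * t)) := by
  have hW : ∀ t ∈ Ici (0 : ℝ), HasDerivWithinAt (fun t => V t * Real.exp (μ * t))
      (V' t * Real.exp (μ * t) + V t * (Real.exp (μ * t) * μ)) (Ici 0) t := by
    intro t ht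
    have h1 : HasDerivAt (fun t : ℝ => Real.exp (μ * t)) (Real.exp (μ * t) * μ) t := by
      simpa using ((hasDerivAt_id t).const_mul μ).exp
    exact (hV t ht).mul h1.hasDerivWithinAt
  have hanti : AntitoneOn (fun t => V t * Real.exp (μ * t)) (Ici 0) := by
    apply antitoneOn_of_hasDerivWithinAt_nonpos (convex_Ici 0)
      (fun t ht => (hW t ht).continuousWithinAt)
      (fun t ht => (hW t (interior_subset ht)).mono interior_subset)
    intro t ht
    have := hle t (interior_subset ht)
    nlinarith [Real.exp_pos (μ * t)]
  have := hanti (mem_Ici.mpr le_rfl) (mem_Ici.mpr ht) ht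
  simp only [mul_zero, Real.exp_zero, mul_one] at this
  rw [Real.exp_neg, ← div_eq_mul_inv, le_div_iff₀ (Real.exp_pos _)]
  exact this

lemma aux_norm {E : Type*} [NormedAddCommGroup E] (e : E) (M V0 μ t : ℝ) (hM : 0 < M)
    (h : M * ‖e‖ ^ 2 ≤ V0 * Real.exp (-(μ * t))) (h0 : 0 ≤ V0) :
    ‖e‖ ≤ (Real.sqrt (V0 / M) + 1) * Real.exp (-(μ * t) / 2) := by
  have h1 : ‖e‖ ≤ Real.sqrt (V0 / M) * Real.exp (-(μ * t) / 2) := by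
    apply aux_sq _ (by positivity)
    rw [mul_pow, Real.sq_sqrt (by positivity), ← Real.exp_nat_mul]
    have : ((2:ℕ):ℝ) * (-(μ * t) / 2) = -(μ * t) := by push_cast; ring
    rw [this, div_mul_eq_mul_div, le_div_iff₀ hM]
    linarith
  nlinarith [Real.exp_pos (-(μ * t) / 2)]

/-- Global exponential convergence of the PI dynamics
`ẋ = −∇f(x) − Σⱼ max(ρ(Cx−d)ⱼ + λⱼ, 0) Cⱼᵀ`,
`λ̇ⱼ = (K_i/ρ)(max(ρ(Cx−d)ⱼ + λⱼ, 0) − λⱼ) + K_p (Cẋ)ⱼ`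
for a smooth strongly convex `f` (with `m_f I ⪯ ∇²f ⪯ L I`), inequality
constraints `Cx − d ≤ 0` with `c̲ I ⪯ CCᵀ ⪯ c̄ I`, `0 < ρ < 1/c̄`,
`K_i ≥ K_p > 0`, and rate
`μ = min{ (1/2) K_p c̲, (2 K_i g̲ − K_p ḡ²)/K_i } > 0`
where `g̲ = m_f` and `ḡ = L + ρ c̄`. -/
theorem PI_global_exponential_convergence (n m : ℕ) (hn : 0 < n) (hm : 0 < m)
    (f : EuclideanSpace ℝ (Fin n) → ℝ) (hf : ContDiff ℝ 2 f)
    (mf L : ℝ) (hmf : 0 < mf) (hmL : mf ≤ L)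
    (hHess : ∀ y v : EuclideanSpace ℝ (Fin n),
      mf * ‖v‖ ^ 2 ≤ iteratedFDeriv ℝ 2 f y ![v, v] ∧
      iteratedFDeriv ℝ 2 f y ![v, v] ≤ L * ‖v‖ ^ 2)
    (C : Matrix (Fin m) (Fin n) ℝ) (d : Fin m → ℝ)
    (cl cu : ℝ) (hcl : 0 < cl) (hclcu : cl ≤ cu)
    (hClow : (C * Cᵀ - cl • (1 : Matrix (Fin m) (Fin m) ℝ)).PosSemidef)
    (hCup : (cu • (1 : Matrix (Fin m) (Fin m) ℝ) - C * Cᵀ).PosSemidef)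
    (ρ : ℝ) (hρ : 0 < ρ) (hρcu : ρ < 1 / cu)
    (Ki Kp : ℝ) (hKp : 0 < Kp) (hKiKp : Kp ≤ Ki)
    -- equilibrium of the PI dynamics
    (xs : EuclideanSpace ℝ (Fin n)) (ls : EuclideanSpace ℝ (Fin m))
    (heq1 : gradient f xs
      + ∑ j, max (ρ * (C.mulVec xs j - d j) + ls j) 0 • toEuc (C j) = 0)
    (heq2 : ∀ j, max (ρ * (C.mulVec xs j - d j) + ls j) 0 = ls j)
    -- the convergence rate
    (μ : ℝ)
    (hμdef : μ = min (1 / 2 * Kp * cl)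
      ((2 * Ki * mf - Kp * (L + ρ * cu) ^ 2) / Ki))
    (hμ : 0 < μ)
    -- a continuously differentiable solution of the PI dynamics on [0, ∞)
    (x : ℝ → EuclideanSpace ℝ (Fin n)) (lam : ℝ → EuclideanSpace ℝ (Fin m))
    (x' : ℝ → EuclideanSpace ℝ (Fin n)) (lam' : ℝ → EuclideanSpace ℝ (Fin m))
    (hx : ∀ t ∈ Ici (0 : ℝ), HasDerivWithinAt x (x' t) (Ici 0) t)
    (hlam : ∀ t ∈ Ici (0 : ℝ), HasDerivWithinAt lam (lam' t) (Ici 0) t)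
    (hx' : ContinuousOn x' (Ici 0)) (hlam' : ContinuousOn lam' (Ici 0))
    (hode1 : ∀ t ∈ Ici (0 : ℝ), x' t = -gradient f (x t)
      - ∑ j, max (ρ * (C.mulVec (x t) j - d j) + lam t j) 0 • toEuc (C j))
    (hode2 : ∀ t ∈ Ici (0 : ℝ), ∀ j, lam' t j =
      Ki / ρ * (max (ρ * (C.mulVec (x t) j - d j) + lam t j) 0 - lam t j)
        + Kp * C.mulVec (x' t) j) :
    ∃ α₁ > (0 : ℝ), ∃ α₂ > (0 : ℝ), ∀ t ≥ (0 : ℝ),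
      ‖x t - xs‖ ≤ α₁ * Real.exp (-(μ * t) / 2) ∧
      ‖lam t - ls‖ ≤ α₂ * Real.exp (-(μ * t) / 2) := by
  have hKi : 0 < Ki := by linarith
  set A : EuclideanSpace ℝ (Fin n) →ₗ[ℝ] EuclideanSpace ℝ (Fin m) := Matrix.toEuclideanLin C with hA
  set T : EuclideanSpace ℝ (Fin m) →ₗ[ℝ] EuclideanSpace ℝ (Fin n) := Matrix.toEuclideanLin Cᵀ with hT
  have hAv : ∀ z j, A z j = C.mulVec z j := fun z j => by simp [hA, Matrix.toLpLin_apply]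
  have hTv : ∀ w j, T w j = Cᵀ.mulVec w j := fun z j => by simp [hT, Matrix.toLpLin_apply]
  have hadj : ∀ w z, inner ℝ (T w) z = inner ℝ w (A z) := by
    intro w z
    simp only [PiLp.inner_apply, hAv, hTv, RCLike.inner_apply, conj_trivial, Matrix.mulVec,
      dotProduct, Finset.mul_sum, Matrix.transpose_apply]
    simp only [Finset.sum_mul]
    rw [Finset.sum_comm]
    refine Finset.sum_congr rfl fun i _ => Finset.sum_congr rfl fun j _ => by ring
  have hTsum : ∀ a : EuclideanSpace ℝ (Fin m), ∑ j, a j • toEuc (C j) = T a := by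
    intro a
    ext i
    simp [hTv, toEuc, Matrix.mulVec, dotProduct, mul_comm]
  have hTn : ∀ w : EuclideanSpace ℝ (Fin m), ‖T w‖ ^ 2 = (w : Fin m → ℝ) ⬝ᵥ (C * Cᵀ).mulVec w := by
    intro w
    rw [← real_inner_self_eq_norm_sq, hadj, ← Matrix.mulVec_mulVec]
    simp only [PiLp.inner_apply, hAv, RCLike.inner_apply, conj_trivial, dotProduct]
    refine Finset.sum_congr rfl fun i _ => ?_
    have : (T w : Fin n → ℝ) = Cᵀ.mulVec w := funext (hTv w)
    rw [this]; ring
  have hwn : ∀ w : EuclideanSpace ℝ (Fin m), ‖w‖ ^ 2 = (w : Fin m → ℝ) ⬝ᵥ (w : Fin m → ℝ) := by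
    intro w
    rw [EuclideanSpace.real_norm_sq_eq]
    simp [dotProduct, sq]
  have hT1 : ∀ w, cl * ‖w‖ ^ 2 ≤ ‖T w‖ ^ 2 := by
    intro w
    have := hClow.dotProduct_mulVec_nonneg (w : Fin m → ℝ)
    simp only [star_trivial, Matrix.sub_mulVec, Matrix.smul_mulVec, Matrix.one_mulVec,
      dotProduct_sub, dotProduct_smul, smul_eq_mul] at this
    rw [hTn, hwn]; linarith
  have hT2 : ∀ w, ‖T w‖ ^ 2 ≤ cu * ‖w‖ ^ 2 := by
    intro w
    have := hCup.dotProduct_mulVec_nonneg (w : Fin m → ℝ)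
    simp only [star_trivial, Matrix.sub_mulVec, Matrix.smul_mulVec, Matrix.one_mulVec,
      dotProduct_sub, dotProduct_smul, smul_eq_mul] at this
    rw [hTn, hwn]; linarith
  have hμ1 : μ ≤ 1 / 2 * Kp * cl := hμdef ▸ min_le_left _ _
  have hμ2 : μ ≤ (2 * Ki * mf - Kp * (L + ρ * cu) ^ 2) / Ki := hμdef ▸ min_le_right _ _
  have main : ∀ t ∈ Ici (0 : ℝ), 2 * Ki * inner ℝ (x t - xs) (x' t)
      + 2 * inner ℝ (lam t - ls) (lam' t) ≤ -μ * (Ki * ‖x t - xs‖ ^ 2 + ‖lam t - ls‖ ^ 2) := by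
    intro t ht
    choose γ hγ0 hγ1 hγ using fun j => aux_max (ρ * (C.mulVec (x t) j - d j) + lam t j)
      (ρ * (C.mulVec xs j - d j) + ls j)
    have hdiff : ∀ j, max (ρ * (C.mulVec (x t) j - d j) + lam t j) 0 = ls j
        + γ j * (ρ * A (x t - xs) j + (lam t - ls) j) := by
      intro j
      have := hγ j
      rw [heq2] at this
      rw [map_sub, PiLp.sub_apply, PiLp.sub_apply, hAv, hAv]
      linear_combination this
    set z := x t - xs with hz
    set w := lam t - ls with hw
    obtain ⟨y1, hy1⟩ := aux_grad f hf xs (x t) z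
    obtain ⟨y2, hy2⟩ := aux_grad f hf xs (x t) (gradient f (x t) - gradient f xs)
    set h := gradient f (x t) - gradient f xs with hh
    set r : EuclideanSpace ℝ (Fin m) := WithLp.toLp 2 (fun j => γ j * A z j) with hr
    set q : EuclideanSpace ℝ (Fin m) := WithLp.toLp 2 (fun j => γ j * w j) with hq
    have hrj : ∀ j, r j = γ j * A z j := fun j => rfl
    have hqj : ∀ j, q j = γ j * w j := fun j => rfl
    have hsj : ∀ j, (w - q) j = w j - γ j * w j := fun j => rfl
    have hxt : x' t = -h - T (ρ • r + q) := by
      have e1 : ∑ j, max (ρ * (C.mulVec (x t) j - d j) + lam t j) 0 • toEuc (C j)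
          = T (ls + (ρ • r + q)) := by
        rw [← hTsum]
        refine Finset.sum_congr rfl fun j _ => ?_
        rw [hdiff]
        congr 1
        simp only [PiLp.add_apply, PiLp.smul_apply, smul_eq_mul, hrj, hqj]
        ring
      have e2 : gradient f xs + T ls = 0 := by
        rw [← heq1, ← hTsum]
        simp only [heq2]
      rw [hode1 t ht, e1, map_add, hh, eq_neg_of_add_eq_zero_left e2]
      abel
    refine aux_core A T hadj mf L cl cu ρ Ki Kp μ (by linarith) hcl hclcu hT1 hT2 hρ hρcu hKp
      hKiKp hμ1 hμ2 z h w r q ?_ ?_ ?_ ?_ ?_ ?_ (x' t) (lam' t) hxt ?_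
    · rw [hy1]; exact (hHess y1 z).1
    · rw [real_inner_self_eq_norm_sq] at hy2
      have := aux_hess f hf mf L hmf hmL hHess y2 z h
      rw [← hy2] at this
      rcases (norm_nonneg h).eq_or_lt with h0 | h0
      · rw [← h0]; have : 0 < L := by linarith
        positivity
      · rw [sq] at this; exact le_of_mul_le_mul_right this h0
    · simp only [PiLp.inner_apply, RCLike.inner_apply, conj_trivial, hrj]
      refine Finset.sum_nonneg fun j _ => ?_
      nlinarith [mul_nonneg (hγ0 j) (sq_nonneg (A z j))]
    · apply aux_sq _ (norm_nonneg _)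
      rw [EuclideanSpace.real_norm_sq_eq, EuclideanSpace.real_norm_sq_eq]
      refine Finset.sum_le_sum fun j _ => ?_
      rw [hrj, mul_pow]
      exact mul_le_of_le_one_left (sq_nonneg _) (pow_le_one₀ (hγ0 j) (hγ1 j))
    · simp only [PiLp.inner_apply, RCLike.inner_apply, conj_trivial, hrj, hqj]
      refine Finset.sum_congr rfl fun j _ => by ring
    · rw [EuclideanSpace.real_norm_sq_eq]
      simp only [PiLp.inner_apply, RCLike.inner_apply, conj_trivial, hsj]
      refine Finset.sum_le_sum fun j _ => ?_
      have : 0 ≤ (γ j * (1 - γ j)) * (w j) ^ 2 :=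
        mul_nonneg (mul_nonneg (hγ0 j) (by linarith [hγ1 j])) (sq_nonneg _)
      nlinarith
    · ext j
      rw [hode2 t ht j, hdiff]
      simp only [PiLp.add_apply, PiLp.sub_apply, PiLp.smul_apply, smul_eq_mul, hrj, hqj, hAv, hw]
      ring
  have hdec := aux_decay (fun t => Ki * ‖x t - xs‖ ^ 2 + ‖lam t - ls‖ ^ 2)
    (fun t => 2 * Ki * inner ℝ (x t - xs) (x' t) + 2 * inner ℝ (lam t - ls) (lam' t)) μ
    (fun t ht => by
      have h1 := ((hx t ht).sub_const xs).norm_sq.const_mul Ki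
      have h2 := ((hlam t ht).sub_const ls).norm_sq
      exact (h1.add h2).congr_deriv (by ring)) main
  set V0 := Ki * ‖x 0 - xs‖ ^ 2 + ‖lam 0 - ls‖ ^ 2 with hV0
  have hV0n : 0 ≤ V0 := by positivity
  refine ⟨Real.sqrt (V0 / Ki) + 1, by positivity, Real.sqrt (V0 / 1) + 1, by positivity,
    fun t ht => ?_⟩
  have hd := hdec t ht
  constructor
  · refine aux_norm _ Ki V0 μ t hKi ?_ hV0n
    nlinarith [sq_nonneg ‖lam t - ls‖]
  · refine aux_norm _ 1 V0 μ t one_pos ?_ hV0n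
    nlinarith [mul_nonneg hKi.le (sq_nonneg ‖x t - xs‖)]
end

section
/- Let n and m be positive integers, let f : ℝⁿ → ℝ be differentiable, let C be a real m×n matrix with rows C_j, let d ∈ ℝᵐ, and let ρ > 0. Suppose (x⋆, λ⋆) ∈ ℝⁿ × ℝᵐ satisfies the equilibrium conditions ∇f(x⋆) + Σ_{j=1}^m max(ρ(Cx⋆−d)_j + λ⋆_j, 0)·C_jᵀ = 0 and max(ρ(Cx⋆−d)_j + λ⋆_j, 0) = λ⋆_j for every j = 1,…,m. Then (x⋆, λ⋆) satisfies the KKT first-order conditions for the problem min f(x) subject to Cx − d ≤ 0: ∇f(x⋆) + Cᵀλ⋆ = 0, λ⋆ ≥ 0 componentwise, Cx⋆ − d ≤ 0 componentwise, and (λ⋆)ᵀ(Cx⋆ − d) = 0. -/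
open Matrix

/-- An equilibrium of the PI dynamics satisfies the KKT first-order
conditions for `min f(x)` s.t. `Cx − d ≤ 0`. -/
theorem equilibrium_satisfies_KKT (n m : ℕ) (hn : 0 < n) (hm : 0 < m)
    (f : EuclideanSpace ℝ (Fin n) → ℝ) (hf : Differentiable ℝ f)
    (C : Matrix (Fin m) (Fin n) ℝ) (d : Fin m → ℝ) (ρ : ℝ) (hρ : 0 < ρ)
    (xs : EuclideanSpace ℝ (Fin n)) (ls : Fin m → ℝ)
    (heq1 : gradient f xs
      + ∑ j, max (ρ * (C.mulVec xs j - d j) + ls j) 0 • toEuc (C j) = 0)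
    (heq2 : ∀ j, max (ρ * (C.mulVec xs j - d j) + ls j) 0 = ls j) :
    gradient f xs + toEuc (Cᵀ.mulVec ls) = 0 ∧
    (∀ j, 0 ≤ ls j) ∧
    (∀ j, C.mulVec xs j - d j ≤ 0) ∧
    ls ⬝ᵥ (C.mulVec xs - d) = 0 := by
  have h0 : ∀ j, 0 ≤ ls j := fun j => by
    rw [← heq2 j]; exact le_max_right _ _
  have h1 : ∀ j, C.mulVec xs j - d j ≤ 0 := fun j => by
    have h := le_max_left (ρ * (C.mulVec xs j - d j) + ls j) 0
    rw [heq2 j] at h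
    by_contra hc
    have := mul_pos hρ (not_le.mp hc)
    linarith
  refine ⟨?_, h0, h1, ?_⟩
  · have hs : toEuc (Cᵀ.mulVec ls) = ∑ j, ls j • toEuc (C j) := by
      unfold toEuc
      simp only [← map_smul, ← map_sum]
      congr 1
      ext i
      simp [Matrix.mulVec, dotProduct, Finset.sum_apply, mul_comm]
    rw [hs]
    simpa only [heq2] using heq1
  · unfold dotProduct
    refine Finset.sum_eq_zero fun j _ => ?_
    rw [Pi.sub_apply]
    rcases max_choice (ρ * (C.mulVec xs j - d j) + ls j) 0 with h | h
    · rw [heq2 j] at h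
      have h2 : ρ * (C.mulVec xs j - d j) = 0 := by linarith
      rcases mul_eq_zero.mp h2 with h3 | h3
      · exact absurd h3 hρ.ne'
      · rw [h3, mul_zero]
    · rw [heq2 j] at h
      rw [h, zero_mul]
end

section
/- Let n, m be positive integers, C a real m×n matrix with rows C_j, d ∈ ℝᵐ, ρ > 0, and define the penalty gradients G_x(x, λ) = Σ_{j=1}^m max(ρ(Cx−d)_j + λ_j, 0)·C_jᵀ ∈ ℝⁿ and G_λ(x, λ) ∈ ℝᵐ with j-th component ( max(ρ(Cx−d)_j + λ_j, 0) − λ_j )/ρ. Then for all (x, λ) and (x⋆, λ⋆) in ℝⁿ × ℝᵐ there exists a diagonal m×m matrix Γ with all diagonal entries in [0,1] such that simultaneously G_x(x,λ) − G_x(x⋆,λ⋆) = ρ·CᵀΓC·(x − x⋆) + CᵀΓ·(λ − λ⋆) and G_λ(x,λ) − G_λ(x⋆,λ⋆) = Γ·C·(x − x⋆) + (1/ρ)·(Γ − I)·(λ − λ⋆). -/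
open Matrix

lemma max_diff_slope (a b : ℝ) :
    ∃ g : ℝ, g ∈ Set.Icc (0 : ℝ) 1 ∧ max a 0 - max b 0 = g * (a - b) := by
  by_cases hab : a = b
  · exact ⟨0, by simp, by simp [hab]⟩
  have h : a - b ≠ 0 := sub_ne_zero.mpr hab
  refine ⟨(max a 0 - max b 0) / (a - b), ?_, by field_simp⟩
  rcases lt_or_gt_of_ne hab with h1 | h1
  · have h2 : a - b < 0 := by linarith
    constructor
    · apply div_nonneg_of_nonpos _ h2.le
      have := max_le_max_right 0 h1.le
      linarith
    · rw [div_le_one_of_neg h2]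
      rcases max_cases a 0 with h3 | h3 <;> rcases max_cases b 0 with h4 | h4 <;> linarith
  · have h2 : 0 < a - b := by linarith
    constructor
    · apply div_nonneg _ h2.le
      have := max_le_max_right 0 h1.le
      linarith
    · rw [div_le_one h2]
      rcases max_cases a 0 with h3 | h3 <;> rcases max_cases b 0 with h4 | h4 <;> linarith

/-- Linear form of the difference of the penalty gradients: there is a
diagonal matrix `Γ` with diagonal entries in `[0,1]` such that
`G_x(x,λ) − G_x(x⋆,λ⋆) = ρ CᵀΓC (x − x⋆) + CᵀΓ (λ − λ⋆)` and
`G_λ(x,λ) − G_λ(x⋆,λ⋆) = ΓC (x − x⋆) + (1/ρ)(Γ − I)(λ − λ⋆)`. -/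
theorem penalty_gradient_linear_form (n m : ℕ) (hn : 0 < n) (hm : 0 < m)
    (C : Matrix (Fin m) (Fin n) ℝ) (d : Fin m → ℝ) (ρ : ℝ) (hρ : 0 < ρ)
    (Gx : (Fin n → ℝ) → (Fin m → ℝ) → (Fin n → ℝ))
    (Gl : (Fin n → ℝ) → (Fin m → ℝ) → (Fin m → ℝ))
    (hGx : ∀ x lam, Gx x lam = ∑ j, max (ρ * (C.mulVec x j - d j) + lam j) 0 • C j)
    (hGl : ∀ x lam j, Gl x lam j = (max (ρ * (C.mulVec x j - d j) + lam j) 0 - lam j) / ρ)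
    (x xs : Fin n → ℝ) (lam ls : Fin m → ℝ) :
    ∃ γ : Fin m → ℝ, (∀ j, γ j ∈ Set.Icc (0 : ℝ) 1) ∧
      Gx x lam - Gx xs ls =
        ρ • (Cᵀ * Matrix.diagonal γ * C).mulVec (x - xs)
          + (Cᵀ * Matrix.diagonal γ).mulVec (lam - ls) ∧
      Gl x lam - Gl xs ls =
        (Matrix.diagonal γ * C).mulVec (x - xs)
          + (1 / ρ) • (Matrix.diagonal γ - 1).mulVec (lam - ls) := by
  choose γ hγ h using fun j => max_diff_slope (ρ * (C.mulVec x j - d j) + lam j)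
    (ρ * (C.mulVec xs j - d j) + ls j)
  refine ⟨γ, hγ, ?_, ?_⟩
  · rw [hGx, hGx, ← Finset.sum_sub_distrib]
    simp_rw [← sub_smul, h]
    simp only [← Matrix.mulVec_mulVec, ← Matrix.mulVec_smul, ← Matrix.mulVec_add]
    simp only [Matrix.mulVec_add, Matrix.mulVec_smul, Matrix.mulVec_sub C]
    simp only [← Matrix.mulVec_smul Cᵀ, ← Matrix.mulVec_add Cᵀ]
    ext i
    simp only [Finset.sum_apply, Pi.smul_apply, smul_eq_mul]
    rw [Matrix.mulVec, dotProduct]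
    refine Finset.sum_congr rfl fun j _ => ?_
    simp only [Matrix.mulVec_diagonal, Matrix.transpose_apply, Pi.add_apply, Pi.sub_apply,
      Pi.smul_apply, smul_eq_mul]
    ring
  · ext j
    rw [← Matrix.mulVec_mulVec, Matrix.sub_mulVec, Matrix.mulVec_sub C, Matrix.one_mulVec]
    simp only [Matrix.mulVec_diagonal, Pi.add_apply, Pi.sub_apply,
      Pi.smul_apply, smul_eq_mul, hGl]
    have := h j
    field_simp
    linarith
end

section
/- Let C be a real m×n matrix, c̄ > 0 with C·Cᵀ ⪯ c̄·I, let 0 < ρ < 1/c̄, let K_i ≥ K_p > 0, and let Γ be a diagonal m×m matrix with all diagonal entries in [0,1]. Then K_p·C·CᵀΓ + K_p·Γ·C·Cᵀ + 2(K_i/ρ)·(I − Γ) ⪰ (3/2)·K_p·C·Cᵀ. -/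
open Matrix

/-- Lower bound on the `Q₃` block in the Lyapunov analysis:
`K_p CCᵀΓ + K_p ΓCCᵀ + 2(K_i/ρ)(I − Γ) ⪰ (3/2) K_p CCᵀ`. -/
theorem Q3_block_bound (m n : ℕ) (C : Matrix (Fin m) (Fin n) ℝ)
    (cu ρ Ki Kp : ℝ) (hcu : 0 < cu)
    (hC : (cu • (1 : Matrix (Fin m) (Fin m) ℝ) - C * Cᵀ).PosSemidef)
    (hρ : 0 < ρ) (hρcu : ρ < 1 / cu) (hKp : 0 < Kp) (hKiKp : Kp ≤ Ki)
    (γ : Fin m → ℝ) (hγ : ∀ j, γ j ∈ Set.Icc (0 : ℝ) 1) :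
    (Kp • (C * Cᵀ * Matrix.diagonal γ) + Kp • (Matrix.diagonal γ * (C * Cᵀ))
      + (2 * Ki / ρ) • ((1 : Matrix (Fin m) (Fin m) ℝ) - Matrix.diagonal γ)
      - (3 / 2 * Kp) • (C * Cᵀ)).PosSemidef := by
  have hM : (C * Cᵀ).PosSemidef := by
    simpa [conjTranspose_eq_transpose_of_trivial] using posSemidef_self_mul_conjTranspose C
  generalize C * Cᵀ = M at hM hC ⊢
  have h1 := (hM.mul_mul_conjTranspose_same (diagonal fun i => 2 * γ i - 1)).smul
    (show (0 : ℝ) ≤ Kp / 2 by positivity)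
  have h2 := (hC.mul_mul_conjTranspose_same (diagonal fun i => 1 - γ i)).smul
    (show (0 : ℝ) ≤ 2 * Kp by positivity)
  have hk : Kp * cu ≤ Ki / ρ := by
    rw [lt_div_iff₀ hcu] at hρcu
    rw [le_div_iff₀ hρ]
    nlinarith
  have h3 : (diagonal fun i => 2 * (Ki / ρ) * (1 - γ i)
      - 2 * Kp * cu * (1 - γ i) ^ 2 : Matrix (Fin m) (Fin m) ℝ).PosSemidef := by
    refine PosSemidef.diagonal fun i => ?_
    obtain ⟨h0, h1⟩ := hγ i
    have a : 0 ≤ (Ki / ρ - Kp * cu) * (1 - γ i) := mul_nonneg (by linarith) (by linarith)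
    have b : 0 ≤ Kp * cu * ((1 - γ i) * γ i) :=
      mul_nonneg (by positivity) (mul_nonneg (by linarith) h0)
    show 0 ≤ 2 * (Ki / ρ) * (1 - γ i) - 2 * Kp * cu * (1 - γ i) ^ 2
    nlinarith
  convert (h1.add h2).add h3 using 1
  ext i j
  simp only [diagonal_conjTranspose, Matrix.add_apply, Matrix.sub_apply, Matrix.smul_apply,
    mul_diagonal, diagonal_mul, smul_eq_mul, Pi.star_apply, star_trivial]
  by_cases h : i = j
  · subst h
    simp only [diagonal_apply_eq, one_apply_eq]
    ring
  · simp only [diagonal_apply_ne _ h, one_apply_ne h]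
    ring
end

section
/- Let w > 0, ρ > 0 and η > 0 be real numbers and let Ã₁ be the 2×2 real matrix with rows (−w−ρ, −1) and (η, 0). Then the characteristic polynomial of Ã₁ is X² + (w + ρ)·X + η, and for every η > 0 there exists a complex eigenvalue of Ã₁ whose real part is greater than or equal to −(w + ρ)/2. -/
open Matrix Polynomial

/-- Characteristic polynomial of the constraint-active mode matrix `Ã₁` of
PDGD, and the fact that some complex eigenvalue has real part `≥ −(w+ρ)/2`. -/
theorem PDGD_mode1_charpoly_and_eigenvalue (w ρ η : ℝ)
    (hw : 0 < w) (hρ : 0 < ρ) (hη : 0 < η)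
    (A1 : Matrix (Fin 2) (Fin 2) ℝ)
    (hA1 : A1 = !![-w - ρ, -1; η, 0]) :
    A1.charpoly = X ^ 2 + Polynomial.C (w + ρ) * X + Polynomial.C η ∧
    ∃ z ∈ spectrum ℂ (A1.map (Complex.ofReal : ℝ → ℂ)),
      -(w + ρ) / 2 ≤ z.re := by
  subst hA1
  constructor
  · rw [Matrix.charpoly_fin_two, Matrix.trace_fin_two, Matrix.det_fin_two]
    simp
    ring
  · have hs : ∃ s : ℂ, s * s = ((w : ℂ) + ρ) ^ 2 - 4 * η ∧ 0 ≤ s.re := by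
      obtain ⟨s, hs⟩ := IsAlgClosed.exists_pow_nat_eq (((w : ℂ) + ρ) ^ 2 - 4 * η) (n := 2) (by norm_num)
      rcases le_total 0 s.re with h | h
      · exact ⟨s, by rw [← hs]; ring, h⟩
      · exact ⟨-s, by rw [← hs]; ring, by simpa using h⟩
    obtain ⟨s, hs, hre⟩ := hs
    refine ⟨((-(w + ρ) / 2 : ℝ) : ℂ) + ((1 / 2 : ℝ) : ℂ) * s, ?_, ?_⟩
    · rw [spectrum.mem_iff, Matrix.isUnit_iff_isUnit_det, isUnit_iff_ne_zero, not_not,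
        Matrix.det_fin_two]
      simp only [Matrix.sub_apply, Matrix.algebraMap_matrix_apply]
      simp
      linear_combination (1 / 4 : ℂ) * hs
    · rw [Complex.add_re, Complex.re_ofReal_mul, Complex.ofReal_re]
      linarith
end

section
/- Let f : ℝⁿ → ℝ be a differentiable convex function, C a real m×n matrix, d ∈ ℝᵐ, and suppose x⋆ ∈ ℝⁿ is a minimizer of f over the set {x : Cx − d ≤ 0}. Then there exists λ⋆ ∈ ℝᵐ such that ∇f(x⋆) + Cᵀλ⋆ = 0, λ⋆ ≥ 0 componentwise, and (λ⋆)ᵀ(Cx⋆ − d) = 0. Moreover, if the rows C_j of C indexed by the active set { j : (Cx⋆ − d)_j = 0 } are linearly independent, then λ⋆ is unique. -/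
open Matrix

open Topology Filter

theorem farkas_aux {V ι : Type*} [AddCommGroup V] [Module ℝ V] [DecidableEq ι] (s : Finset ι) :
    ∀ (a : ι → V →ₗ[ℝ] ℝ) (b : V →ₗ[ℝ] ℝ),
      (∀ x, (∀ i ∈ s, a i x ≤ 0) → b x ≤ 0) →
      ∃ l : ι → ℝ, (∀ i, 0 ≤ l i) ∧ (∀ i, i ∉ s → l i = 0) ∧
        ∀ x, b x = ∑ i ∈ s, l i * a i x := by
  induction s using Finset.induction_on with
  | empty =>
    intro a b h
    refine ⟨fun _ => 0, by simp, by simp, fun x => ?_⟩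
    have h1 := h x (by simp)
    have h2 := h (-x) (by simp)
    simp only [map_neg] at h2
    simp only [Finset.sum_empty]
    linarith
  | insert k s hk ih =>
    intro a b h
    by_cases hc : ∀ x, (∀ i ∈ s, a i x ≤ 0) → b x ≤ 0
    · obtain ⟨l, h0, h1, h2⟩ := ih a b hc
      refine ⟨l, h0, fun i hi => h1 i (fun h => hi (Finset.mem_insert_of_mem h)), fun x => ?_⟩
      rw [Finset.sum_insert hk, h1 k hk, h2 x]; ring
    · push Not at hc
      obtain ⟨y, hy, hby⟩ := hc
      have hky : 0 < a k y := by
        by_contra hn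
        push Not at hn
        have := h y (by
          intro i hi
          rcases Finset.mem_insert.1 hi with rfl | hi
          · exact hn
          · exact hy i hi)
        linarith
      let P : V →ₗ[ℝ] V := LinearMap.id - (((a k y)⁻¹ • a k).smulRight y)
      have hP : ∀ x, P x = x - ((a k y)⁻¹ * a k x) • y := fun x => by simp [P]
      obtain ⟨l, h0, h1, h2⟩ := ih (fun i => (a i).comp P) (b.comp P) (by
        intro x hx
        apply h (P x)
        intro i hi
        rcases Finset.mem_insert.1 hi with rfl | hi
        · rw [hP]; simp only [map_sub, map_smul, smul_eq_mul]
          field_simp; simp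
        · exact hx i hi)
      have hs : ∑ i ∈ s, l i * a i y ≤ 0 :=
        Finset.sum_nonpos fun i hi => mul_nonpos_of_nonneg_of_nonpos (h0 i) (hy i hi)
      refine ⟨fun i => if i = k then (a k y)⁻¹ * (b y - ∑ i ∈ s, l i * a i y) else l i,
        ?_, ?_, ?_⟩
      · intro i
        dsimp only
        split_ifs
        · exact mul_nonneg (inv_nonneg.2 hky.le) (by linarith)
        · exact h0 i
      · intro i hi
        have hik : i ≠ k := fun e => hi (by simp [e])
        simp only [hik, if_false]
        exact h1 i (fun h => hi (Finset.mem_insert_of_mem h))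
      · intro x
        rw [Finset.sum_insert hk]
        have e : ∑ i ∈ s, (if i = k then (a k y)⁻¹ * (b y - ∑ i ∈ s, l i * a i y) else l i) * a i x
            = ∑ i ∈ s, l i * a i x := by
          refine Finset.sum_congr rfl fun i hi => ?_
          have hik : i ≠ k := by
            rintro rfl
            exact hk hi
          rw [if_neg hik]
        rw [e]
        simp only [if_true]
        have h3 := h2 x
        simp only [LinearMap.comp_apply, hP, map_sub, map_smul, smul_eq_mul] at h3
        have e2 : ∑ i ∈ s, l i * (a i x - (a k y)⁻¹ * a k x * a i y)
            = ∑ i ∈ s, l i * a i x - (a k y)⁻¹ * a k x * ∑ i ∈ s, l i * a i y := by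
          rw [Finset.mul_sum, ← Finset.sum_sub_distrib]
          exact Finset.sum_congr rfl fun i _ => by ring
        rw [e2] at h3
        linarith

theorem kkt_exists (n m : ℕ)
    (f : EuclideanSpace ℝ (Fin n) → ℝ) (hdiff : Differentiable ℝ f)
    (C : Matrix (Fin m) (Fin n) ℝ) (d : Fin m → ℝ)
    (xs : EuclideanSpace ℝ (Fin n))
    (hfeas : ∀ j, C.mulVec xs j - d j ≤ 0)
    (hmin : ∀ y : EuclideanSpace ℝ (Fin n), (∀ j, C.mulVec y j - d j ≤ 0) → f xs ≤ f y) :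
    ∃ ls : Fin m → ℝ,
      gradient f xs + toEuc (Cᵀ.mulVec ls) = 0 ∧ (∀ j, 0 ≤ ls j) ∧
      ls ⬝ᵥ (C.mulVec xs - d) = 0 := by
  classical
  let a : Fin m → EuclideanSpace ℝ (Fin n) →ₗ[ℝ] ℝ := fun j =>
    (LinearMap.proj j).comp (C.mulVecLin.comp (EuclideanSpace.equiv (Fin n) ℝ).toLinearMap)
  have ha : ∀ j x, a j x = C.mulVec x j := fun j x => rfl
  obtain ⟨l, h0, h1, h2⟩ := farkas_aux (Finset.univ.filter fun j => C.mulVec xs j - d j = 0) a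
    (-(fderiv ℝ f xs).toLinearMap) (by
      intro v hv
      let S : Set (EuclideanSpace ℝ (Fin n)) := {y | ∀ j, C.mulVec y j - d j ≤ 0}
      have hloc : IsLocalMinOn f S xs := by
        have : IsMinOn f S xs := fun y hy => hmin y hy
        exact this.localize
      have hv' : v ∈ posTangentConeAt S xs := by
        apply mem_posTangentConeAt_of_frequently_mem
        apply Eventually.frequently
        have : ∀ j, ∀ᶠ t : ℝ in 𝓝[>] 0, a j xs + t * a j v - d j ≤ 0 := by
          intro j
          by_cases hj : C.mulVec xs j - d j = 0
          · filter_upwards [self_mem_nhdsWithin] with t ht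
            have := hv j (by simpa using hj)
            have := mul_nonpos_of_nonneg_of_nonpos (le_of_lt ht) this
            rw [ha j xs]; linarith
          · have hlt : C.mulVec xs j - d j < 0 := lt_of_le_of_ne (hfeas j) hj
            have hc : Continuous fun t : ℝ => a j xs + t * a j v - d j := by fun_prop
            have := hc.continuousAt.eventually_lt (x₀ := 0) (g := fun _ => (0:ℝ)) continuousAt_const
              (by simpa [ha] using hlt)
            exact (this.filter_mono nhdsWithin_le_nhds).mono fun t ht => le_of_lt ht
        filter_upwards [eventually_all.2 this] with t ht j
        have := ht j
        rw [← ha, map_add, map_smul, smul_eq_mul]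
        exact this
      have := hloc.hasFDerivWithinAt_nonneg (hdiff xs).hasFDerivAt.hasFDerivWithinAt hv'
      simpa using this)
  refine ⟨l, ?_, h0, ?_⟩
  · refine ext_inner_right ℝ fun v => ?_
    have hg : inner ℝ (gradient f xs) v = fderiv ℝ f xs v := by
      simp [gradient]
    have h3 := h2 v
    have h4 : inner ℝ (toEuc (Cᵀ.mulVec l)) v = ∑ j, l j * a j v := by
      have : inner ℝ (toEuc (Cᵀ.mulVec l)) v = (Cᵀ.mulVec l) ⬝ᵥ v := by
        simp [toEuc, PiLp.inner_apply, dotProduct, mul_comm]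
      rw [this, Matrix.mulVec_transpose, ← Matrix.dotProduct_mulVec]
      rfl
    have h5 : ∑ j ∈ Finset.univ.filter (fun j => C.mulVec xs j - d j = 0), l j * a j v
        = ∑ j, l j * a j v :=
      Finset.sum_subset (Finset.subset_univ _) fun j _ hj => by rw [h1 j hj, zero_mul]
    rw [inner_add_left, hg, h4, ← h5, ← h3, inner_zero_left]
    simp
  · refine Finset.sum_eq_zero fun j _ => ?_
    by_cases hj : C.mulVec xs j - d j = 0
    · simp [hj]
    · rw [h1 j (by simpa using hj), zero_mul]


/-- KKT first-order conditions for the linearly constrained convex problem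
`min f(x)` s.t. `Cx − d ≤ 0`: existence of a multiplier `λ⋆`, and uniqueness
when the active constraint rows are linearly independent. -/
theorem KKT_first_order_conditions (n m : ℕ)
    (f : EuclideanSpace ℝ (Fin n) → ℝ)
    (hconv : ConvexOn ℝ Set.univ f) (hdiff : Differentiable ℝ f)
    (C : Matrix (Fin m) (Fin n) ℝ) (d : Fin m → ℝ)
    (xs : EuclideanSpace ℝ (Fin n))
    (hfeas : ∀ j, C.mulVec xs j - d j ≤ 0)
    (hmin : ∀ y : EuclideanSpace ℝ (Fin n), (∀ j, C.mulVec y j - d j ≤ 0) → f xs ≤ f y) :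
    (∃ ls : Fin m → ℝ,
      gradient f xs + toEuc (Cᵀ.mulVec ls) = 0 ∧ (∀ j, 0 ≤ ls j) ∧
      ls ⬝ᵥ (C.mulVec xs - d) = 0) ∧
    (LinearIndependent ℝ (fun j : {j : Fin m // C.mulVec xs j - d j = 0} => C j.1) →
      ∃! ls : Fin m → ℝ,
        gradient f xs + toEuc (Cᵀ.mulVec ls) = 0 ∧ (∀ j, 0 ≤ ls j) ∧
        ls ⬝ᵥ (C.mulVec xs - d) = 0) := by
  have hex := kkt_exists n m f hdiff C d xs hfeas hmin
  refine ⟨hex, fun hli => ?_⟩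
  obtain ⟨l, hl⟩ := hex
  have hcs : ∀ u : Fin m → ℝ, (∀ j, 0 ≤ u j) → u ⬝ᵥ (C.mulVec xs - d) = 0 →
      ∀ j, C.mulVec xs j - d j ≠ 0 → u j = 0 := by
    intro u hu h0 j hj
    have := (Finset.sum_eq_zero_iff_of_nonpos (s := Finset.univ)
      (f := fun j => u j * (C.mulVec xs - d) j)
      (fun i _ => mul_nonpos_of_nonneg_of_nonpos (hu i) (hfeas i))).1 h0 j (Finset.mem_univ j)
    exact (mul_eq_zero.1 this).resolve_right hj
  refine ⟨l, hl, fun u hu => ?_⟩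
  have heq : Cᵀ.mulVec u = Cᵀ.mulVec l := by
    have := add_left_cancel (hu.1.trans hl.1.symm)
    exact (EuclideanSpace.equiv (Fin n) ℝ).symm.injective this
  have hul := hcs u hu.2.1 hu.2.2
  have hll := hcs l hl.2.1 hl.2.2
  classical
  have hz : ∑ j : {j : Fin m // C.mulVec xs j - d j = 0}, (u j.1 - l j.1) • C j.1 = 0 := by
    have e : ∑ j : {j : Fin m // C.mulVec xs j - d j = 0}, (u j.1 - l j.1) • C j.1
        = ∑ j, (u j - l j) • C j := by
      rw [← Finset.sum_subtype (Finset.univ.filter fun j => C.mulVec xs j - d j = 0)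
        (by simp) (fun j => (u j - l j) • C j)]
      refine Finset.sum_subset (Finset.subset_univ _) fun j _ hj => ?_
      have hj' : C.mulVec xs j - d j ≠ 0 := by simpa using hj
      rw [hul j hj', hll j hj', sub_zero, zero_smul]
    rw [e]
    ext k
    have := congrFun heq k
    simp only [Matrix.mulVec, dotProduct, Matrix.transpose_apply] at this
    simp only [Finset.sum_apply, Pi.smul_apply, smul_eq_mul, Pi.zero_apply, sub_mul,
      Finset.sum_sub_distrib]
    rw [sub_eq_zero]
    simpa only [mul_comm] using this
  have := Fintype.linearIndependent_iff.1 hli _ hz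
  funext j
  by_cases hj : C.mulVec xs j - d j = 0
  · exact sub_eq_zero.1 (this ⟨j, hj⟩)
  · rw [hul j hj, hll j hj]
end
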